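/- For every real number λ, every positive integer k and every positive integer n, (n)_{k+1,λ} = (k+1)·S_{k,λ}(n) − Σ_{r=0}^{k−1} C(k+1, r) · (−1)^{k+1−r} · ⟨1⟩_{k+1−r,λ} · S_{r,λ}(n). -/

import Mathlib

/-- The degenerate falling factorial `(x)_{n,λ} = x(x-λ)(x-2λ)⋯(x-(n-1)λ)`. -/
def dfact (lam x : ℝ) (n : ℕ) : ℝ := ∏ i ∈ Finset.range n, (x - i * lam)

/-- The degenerate rising factorial `⟨x⟩_{n,λ} = x(x+λ)(x+2λ)⋯(x+(n-1)λ)`. -/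
def drise (lam x : ℝ) (n : ℕ) : ℝ := ∏ i ∈ Finset.range n, (x + i * lam)

/-- `S_{k,λ}(n) = Σ_{j=1}^n (j)_{k,λ}`. -/
def Sdeg (lam : ℝ) (k n : ℕ) : ℝ := ∑ j ∈ Finset.Icc 1 n, dfact lam j k

theorem dfact_succ (lam x : ℝ) (m : ℕ) :
    dfact lam x (m + 1) = dfact lam x m * (x - m * lam) :=
  Finset.prod_range_succ _ _

/-- The degenerate Chu–Vandermonde identity. -/
theorem dfact_add (lam x y : ℝ) (m : ℕ) :
    dfact lam (x + y) m = ∑ p ∈ Finset.HasAntidiagonal.antidiagonal m,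
      (m.choose p.1 : ℝ) * (dfact lam x p.1 * dfact lam y p.2) := by
  induction m with
  | zero => simp [dfact]
  | succ m ih =>
    rw [Finset.sum_antidiagonal_choose_succ_mul
      (fun i j => dfact lam x i * dfact lam y j), dfact_succ, ih, Finset.sum_mul,
      ← Finset.sum_add_distrib]
    refine Finset.sum_congr rfl fun p hp => ?_
    rw [Finset.HasAntidiagonal.mem_antidiagonal] at hp
    have hc : m.choose p.2 = m.choose p.1 :=
      (Nat.choose_symm_of_eq_add hp.symm).symm
    rw [hc, dfact_succ, dfact_succ, ← hp]
    push_cast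
    ring

theorem dfact_neg_one (lam : ℝ) (m : ℕ) : dfact lam (-1) m = (-1) ^ m * drise lam 1 m := by
  induction m with
  | zero => simp [dfact, drise]
  | succ m ih =>
    rw [dfact_succ, ih, drise, drise, Finset.prod_range_succ]
    ring

theorem dfact_zero_left (lam : ℝ) (k : ℕ) : dfact lam 0 (k + 1) = 0 := by
  simp [dfact, Finset.prod_range_succ']

/-- The backward difference of a degenerate falling factorial. -/
theorem dfact_sub_dfact_sub_one (lam x : ℝ) (k : ℕ) :
    dfact lam x (k + 1) - dfact lam (x - 1) (k + 1) =
      (k + 1) * dfact lam x k -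
        ∑ r ∈ Finset.range k,
          ((k + 1).choose r : ℝ) * (-1) ^ (k + 1 - r) * drise lam 1 (k + 1 - r) *
            dfact lam x r := by
  rw [sub_eq_add_neg x 1, dfact_add, Finset.Nat.sum_antidiagonal_eq_sum_range_succ_mk,
    Finset.sum_range_succ, Finset.sum_range_succ]
  have h : ∑ r ∈ Finset.range k, ((k + 1).choose r : ℝ) *
      (dfact lam x r * dfact lam (-1) (k + 1 - r)) =
      ∑ r ∈ Finset.range k, ((k + 1).choose r : ℝ) * (-1) ^ (k + 1 - r) *
        drise lam 1 (k + 1 - r) * dfact lam x r :=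
    Finset.sum_congr rfl fun r _ => by rw [dfact_neg_one]; ring
  simp only [h, Nat.choose_succ_self_right, Nat.choose_self, Nat.sub_self,
    Nat.add_sub_cancel_left]
  simp only [dfact, Finset.prod_range_one, Finset.prod_range_zero]
  push_cast
  ring

theorem Sdeg_succ (lam : ℝ) (k n : ℕ) :
    Sdeg lam k (n + 1) = Sdeg lam k n + dfact lam (n + 1) k := by
  rw [Sdeg, Sdeg, Finset.sum_Icc_succ_top (by omega)]
  push_cast
  rfl

/-- The recurrence expressing `(n)_{k+1,λ}` through the sums `S_{r,λ}(n)` with `r ≤ k`. -/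
theorem dfact_eq_sum_Sdeg (lam : ℝ) (k n : ℕ) :
    dfact lam n (k + 1) =
      (k + 1) * Sdeg lam k n -
        ∑ r ∈ Finset.range k,
          ((k + 1).choose r : ℝ) * (-1) ^ (k + 1 - r) * drise lam 1 (k + 1 - r) *
            Sdeg lam r n := by
  induction n with
  | zero => simp [Sdeg, dfact_zero_left]
  | succ n ih =>
    have h := dfact_sub_dfact_sub_one lam (n + 1) k
    rw [add_sub_cancel_right] at h
    simp only [Sdeg_succ, mul_add, Finset.sum_add_distrib]
    push_cast
    linarith

theorem stmt_10 (lam : ℝ) (k n : ℕ) (hk : 0 < k) (hn : 0 < n) :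
    dfact lam n (k + 1) =
      (k + 1) * Sdeg lam k n -
        ∑ r ∈ Finset.range k,
          ((k + 1).choose r : ℝ) * (-1) ^ (k + 1 - r) * drise lam 1 (k + 1 - r) *
            Sdeg lam r n :=
  dfact_eq_sum_Sdeg lam k n
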